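/- The real scalar function u(x,t) = −2 Bᵀ F(x,t)⁻¹ Cᵀ satisfies the focusing modified Korteweg–de Vries equation u_t + u_{xxx} + 6u²u_x = 0 at every point (x,t) of the real plane. -/

import Mathlib

open Matrix MeasureTheory Filter

noncomputable def mexp {p : ℕ} (M : Matrix (Fin p) (Fin p) ℝ) : Matrix (Fin p) (Fin p) ℝ :=
  ∑' k : ℕ, (k.factorial : ℝ)⁻¹ • M ^ k

def EigPos {p : ℕ} (A : Matrix (Fin p) (Fin p) ℝ) : Prop :=
  ∀ μ ∈ spectrum ℂ (A.map Complex.ofReal), 0 < μ.re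

def Observable {p : ℕ} (A : Matrix (Fin p) (Fin p) ℝ) (C : Matrix (Fin 1) (Fin p) ℝ) : Prop :=
  ∀ v : Fin p → ℝ, (∀ r : ℕ, (C * A ^ r) *ᵥ v = 0) → v = 0

def Controllable {p : ℕ} (A : Matrix (Fin p) (Fin p) ℝ) (B : Matrix (Fin p) (Fin 1) ℝ) : Prop :=
  ∀ v : Fin p → ℝ, (∀ r : ℕ, (Bᵀ * Aᵀ ^ r) *ᵥ v = 0) → v = 0

noncomputable def Qmat {p : ℕ} (A : Matrix (Fin p) (Fin p) ℝ) (C : Matrix (Fin 1) (Fin p) ℝ) :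
    Matrix (Fin p) (Fin p) ℝ :=
  Matrix.of fun i j =>
    ∫ s in Set.Ioi (0 : ℝ), (mexp (-(s • Aᵀ)) * (Cᵀ * C) * mexp (-(s • A))) i j

noncomputable def Nmat {p : ℕ} (A : Matrix (Fin p) (Fin p) ℝ) (B : Matrix (Fin p) (Fin 1) ℝ) :
    Matrix (Fin p) (Fin p) ℝ :=
  Matrix.of fun i j =>
    ∫ s in Set.Ioi (0 : ℝ), (mexp (-(s • A)) * (B * Bᵀ) * mexp (-(s • Aᵀ))) i j

noncomputable def Pmat {p : ℕ} (A : Matrix (Fin p) (Fin p) ℝ) (B : Matrix (Fin p) (Fin 1) ℝ)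
    (C : Matrix (Fin 1) (Fin p) ℝ) : Matrix (Fin p) (Fin p) ℝ :=
  Matrix.of fun i j =>
    ∫ s in Set.Ioi (0 : ℝ), (mexp (-(s • A)) * (B * C) * mexp (-(s • A))) i j

noncomputable def Fmat {p : ℕ} (A : Matrix (Fin p) (Fin p) ℝ) (B : Matrix (Fin p) (Fin 1) ℝ)
    (C : Matrix (Fin 1) (Fin p) ℝ) (x t : ℝ) : Matrix (Fin p) (Fin p) ℝ :=
  mexp ((2 * x) • Aᵀ - (8 * t) • Aᵀ ^ 3) +
    Qmat A C * mexp (-((2 * x) • A) + (8 * t) • A ^ 3) * Nmat A B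

noncomputable def Emat {p : ℕ} (A : Matrix (Fin p) (Fin p) ℝ) (B : Matrix (Fin p) (Fin 1) ℝ)
    (C : Matrix (Fin 1) (Fin p) ℝ) (x t : ℝ) : Matrix (Fin p) (Fin p) ℝ :=
  mexp ((2 * x) • A - (8 * t) • A ^ 3) +
    Pmat A B C * mexp (-((2 * x) • A) + (8 * t) • A ^ 3) * Pmat A B C

noncomputable def uFun {p : ℕ} (A : Matrix (Fin p) (Fin p) ℝ) (B : Matrix (Fin p) (Fin 1) ℝ)
    (C : Matrix (Fin 1) (Fin p) ℝ) (x t : ℝ) : ℝ :=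
  -2 * ((Bᵀ * (Fmat A B C x t)⁻¹ * Cᵀ : Matrix (Fin 1) (Fin 1) ℝ) 0 0)

noncomputable def vFun {p : ℕ} (A : Matrix (Fin p) (Fin p) ℝ) (B : Matrix (Fin p) (Fin 1) ℝ)
    (C : Matrix (Fin 1) (Fin p) ℝ) (x t : ℝ) : ℝ :=
  -2 * ((C * (Emat A B C x t)⁻¹ * B : Matrix (Fin 1) (Fin 1) ℝ) 0 0)

noncomputable def calQ {p : ℕ} (A : Matrix (Fin p) (Fin p) ℝ) (C : Matrix (Fin 1) (Fin p) ℝ)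
    (x t : ℝ) : Matrix (Fin p) (Fin p) ℝ :=
  mexp (-(x • Aᵀ)) * mexp ((8 * t) • Aᵀ ^ 3) * Qmat A C * mexp (-(x • A)) * mexp ((8 * t) • A ^ 3)

noncomputable def calN {p : ℕ} (A : Matrix (Fin p) (Fin p) ℝ) (B : Matrix (Fin p) (Fin 1) ℝ)
    (x : ℝ) : Matrix (Fin p) (Fin p) ℝ :=
  mexp (-(x • A)) * Nmat A B * mexp (-(x • Aᵀ))

noncomputable def Gam {p : ℕ} (A : Matrix (Fin p) (Fin p) ℝ) (B : Matrix (Fin p) (Fin 1) ℝ)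
    (C : Matrix (Fin 1) (Fin p) ℝ) (x t : ℝ) : Matrix (Fin p) (Fin p) ℝ :=
  1 + calQ A C x t * calN A B x

noncomputable def Om {p : ℕ} (A : Matrix (Fin p) (Fin p) ℝ) (B : Matrix (Fin p) (Fin 1) ℝ)
    (C : Matrix (Fin 1) (Fin p) ℝ) (w t : ℝ) : ℝ :=
  ((C * mexp (-(w • A)) * mexp ((8 * t) • A ^ 3) * B : Matrix (Fin 1) (Fin 1) ℝ) 0 0)

noncomputable def Kker {p : ℕ} (A : Matrix (Fin p) (Fin p) ℝ) (B : Matrix (Fin p) (Fin 1) ℝ)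
    (C : Matrix (Fin 1) (Fin p) ℝ) (x y t : ℝ) : ℝ :=
  ((Bᵀ * (Fmat A B C x t)⁻¹ * mexp (-((y - x) • Aᵀ)) * Cᵀ : Matrix (Fin 1) (Fin 1) ℝ) 0 0)

section helpers

attribute [local instance] Matrix.linftyOpNormedRing Matrix.linftyOpNormedAlgebra

lemma mexp_eq {p : ℕ} (M : Matrix (Fin p) (Fin p) ℝ) : mexp M = NormedSpace.exp M := by
  rw [NormedSpace.exp_eq_tsum ℝ]; rfl

lemma mexp_deriv {p : ℕ} (M K : Matrix (Fin p) (Fin p) ℝ) (h : Commute M K) (s : ℝ) :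
    HasDerivAt (fun s : ℝ => mexp (M + s • K)) (K * mexp (M + s • K)) s := by
  simp only [mexp_eq]
  have h1 : ∀ s : ℝ, NormedSpace.exp (M + s • K) =
      NormedSpace.exp (s • K) * NormedSpace.exp M := fun s => by
    rw [add_comm]
    exact Matrix.exp_add_of_commute _ _ ((h.smul_right s).symm)
  simp only [h1]
  rw [← mul_assoc]
  exact (hasDerivAt_exp_smul_const' (𝕂 := ℝ) K s).mul_const _

lemma inv_deriv {p : ℕ} (F : ℝ → Matrix (Fin p) (Fin p) ℝ) (F' : Matrix (Fin p) (Fin p) ℝ) (x : ℝ)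
    (h : HasDerivAt F F' x) (hu : IsUnit (F x)) :
    HasDerivAt (fun y => (F y)⁻¹) (-((F x)⁻¹ * F' * (F x)⁻¹)) x := by
  obtain ⟨U, hU⟩ := hu
  have h2 := hasFDerivAt_ringInverse (𝕜 := ℝ) U
  rw [hU] at h2
  have h3 := h2.comp_hasDerivAt x h
  simp only [Matrix.nonsing_inv_eq_ringInverse]
  have h4 : Ring.inverse (F x) = ↑U⁻¹ := by rw [← hU, Ring.inverse_unit]
  rw [h4]
  exact h3

lemma entry_deriv {p : ℕ} (G : ℝ → Matrix (Fin p) (Fin p) ℝ) (G' : Matrix (Fin p) (Fin p) ℝ) (x : ℝ)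
    (h : HasDerivAt G G' x) {m n : ℕ} (L : Matrix (Fin m) (Fin p) ℝ) (R : Matrix (Fin p) (Fin n) ℝ)
    (i : Fin m) (j : Fin n) :
    HasDerivAt (fun y => (L * G y * R) i j) ((L * G' * R) i j) x := by
  let f : Matrix (Fin p) (Fin p) ℝ →ₗ[ℝ] ℝ :=
    { toFun := fun M => (L * M * R) i j
      map_add' := fun M N => by simp [Matrix.mul_add, Matrix.add_mul]
      map_smul' := fun r M => by simp }
  exact (LinearMap.toContinuousLinearMap f).hasFDerivAt.comp_hasDerivAt x h

section alg
variable {R : Type*} [Ring R] {a A Q N E e F G b c : R}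

lemma alg_main (hF : F = e + Q * E * N) (hFG : F * G = 1) (hGF : G * F = 1)
    (hQ : a * Q + Q * A = c) (hN : A * N + N * a = b) (hE : A * E = E * A) (he : a * e = e * a) :
    A * (E * N * G) + (E * N * G) * a = (E - (E * N * G) * Q * E) * b * G
      + (E * N * G) * c * (E * N * G) := by
  have h1 : E * N * G * (Q * E * N) = E * N - E * N * G * e := by
    have : Q * E * N = F - e := by rw [hF]; abel
    rw [this, mul_sub, mul_assoc (E * N), hGF, mul_one]
  have h2 : a * Q * (E * N * G) = a - a * e * G := by
    have : a * Q * (E * N * G) = a * (F - e) * G := by rw [hF]; noncomm_ring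
    rw [this, mul_sub, sub_mul, mul_assoc a F, hFG, mul_one]
  subst hQ hN
  have e1 : (E - (E * N * G) * Q * E) * (A * N + N * a) * G
      = (E * A) * N * G + E * N * a * G - E * N * G * Q * (E * A) * N * G
        - (E * N * G * (Q * E * N)) * a * G := by noncomm_ring
  have e2 : (E * N * G) * (a * Q + Q * A) * (E * N * G)
      = E * N * G * (a * Q * (E * N * G)) + E * N * G * Q * (A * E) * N * G := by noncomm_ring
  rw [e1, e2, h1, h2, hE, he, ← hE]
  noncomm_ring

lemma alg_x (hF : F = e + Q * E * N) (hFG : F * G = 1)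
    (hQ : a * Q + Q * A = c) :
    -(G * (2 * (a * e) - 2 * (Q * A * E * N)) * G) = -2 * (G * a) + 2 * (G * c * (E * N * G)) := by
  have h2 : a * (F * G) = a := by rw [hFG, mul_one]
  rw [hF] at h2
  subst hQ
  nth_rw 2 [← h2]
  noncomm_ring

lemma alg_t (hF : F = e + Q * E * N) (hFG : F * G = 1)
    (hQ : a * Q + Q * A = c) :
    -(G * (-8 * (a ^ 3 * e) + 8 * (Q * A ^ 3 * E * N)) * G) = 8 * (G * a ^ 3) -
      8 * (G * (c * A ^ 2 - a * c * A + a ^ 2 * c) * (E * N * G)) := by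
  have h2 : a ^ 3 * (F * G) = a ^ 3 := by rw [hFG, mul_one]
  rw [hF] at h2
  subst hQ
  nth_rw 2 [← h2]
  noncomm_ring

lemma alg_D {Et et : R} (hF : F = e + Q * E * N) (hGF : G * F = 1)
    (h1 : E * et = 1) (h2 : e * Et = 1) :
    (E - (E * N * G) * Q * E) * (et + N * Et * Q) = 1 := by
  have h3 : E * N * G * (Q * E * N) = E * N - E * N * G * e := by
    have : Q * E * N = F - e := by rw [hF]; abel
    rw [this, mul_sub, mul_assoc (E * N), hGF, mul_one]
  have : (E - (E * N * G) * Q * E) * (et + N * Et * Q) = E * et + E * N * Et * Q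
     - E * N * G * Q * (E * et) - (E * N * G * (Q * E * N)) * Et * Q := by noncomm_ring
  rw [this, h3, h1]
  have : (E * N - E * N * G * e) * Et * Q = E * N * Et * Q - E * N * G * (e * Et) * Q := by
    noncomm_ring
  rw [this, h2]
  noncomm_ring
end alg


/-- the exponential -/
noncomputable def Eex {p : ℕ} (A : Matrix (Fin p) (Fin p) ℝ) (x t : ℝ) : Matrix (Fin p) (Fin p) ℝ :=
  mexp (-((2 * x) • A) + (8 * t) • A ^ 3)

lemma mexp_transpose {p : ℕ} (M : Matrix (Fin p) (Fin p) ℝ) : mexp Mᵀ = (mexp M)ᵀ := by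
  rw [mexp_eq, mexp_eq, Matrix.exp_transpose]

lemma mexp_mul_neg {p : ℕ} (M : Matrix (Fin p) (Fin p) ℝ) : mexp M * mexp (-M) = 1 := by
  rw [mexp_eq, mexp_eq, ← Matrix.exp_add_of_commute _ _ (Commute.refl M).neg_right]
  simp [NormedSpace.exp_zero]

lemma mexp_neg_mul {p : ℕ} (M : Matrix (Fin p) (Fin p) ℝ) : mexp (-M) * mexp M = 1 := by
  simpa using mexp_mul_neg (-M)

lemma mexp_comm {p : ℕ} (M K : Matrix (Fin p) (Fin p) ℝ) (h : Commute M K) :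
    M * mexp K = mexp K * M := by
  rw [mexp_eq]; exact h.exp_right

lemma pow_comm' {p : ℕ} (A : Matrix (Fin p) (Fin p) ℝ) (r s : ℝ) : Commute A (r • A + s • A ^ 3) :=
  ((Commute.refl A).smul_right r).add_right (((Commute.refl A).pow_right 3).smul_right s)

lemma mexp_dx {p : ℕ} (A : Matrix (Fin p) (Fin p) ℝ) (r s x : ℝ) :
    HasDerivAt (fun x : ℝ => mexp ((r * x) • A + s • A ^ 3))
      (r • A * mexp ((r * x) • A + s • A ^ 3)) x := by
  have h := mexp_deriv (s • A ^ 3) (r • A)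
    ((((Commute.refl A).pow_right 3).smul_right s).smul_left r).symm x
  have e : ∀ x : ℝ, (r * x) • A + s • A ^ 3 = s • A ^ 3 + x • r • A := fun x => by
    rw [smul_smul, mul_comm, add_comm]
  simpa only [e] using h

lemma mexp_dt {p : ℕ} (A : Matrix (Fin p) (Fin p) ℝ) (r s x : ℝ) :
    HasDerivAt (fun x : ℝ => mexp (s • A + (r * x) • A ^ 3))
      (r • A ^ 3 * mexp (s • A + (r * x) • A ^ 3)) x := by
  have h := mexp_deriv (s • A) (r • A ^ 3)
    ((((Commute.refl A).pow_right 3).smul_right r).smul_left s) x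
  have e : ∀ x : ℝ, s • A + (r * x) • A ^ 3 = s • A + x • r • A ^ 3 := fun x => by
    rw [smul_smul, mul_comm]
  simpa only [e] using h

lemma Eex_eq {p : ℕ} (A : Matrix (Fin p) (Fin p) ℝ) (x t : ℝ) :
    Eex A x t = mexp ((-2 * x) • A + (8 * t) • A ^ 3) := by
  unfold Eex; congr 2; rw [← neg_smul]; congr 1; ring

lemma eex_eq {p : ℕ} (A : Matrix (Fin p) (Fin p) ℝ) (x t : ℝ) :
    mexp ((2 * x) • A - (8 * t) • A ^ 3) = mexp ((2 * x) • A + (-8 * t) • A ^ 3) := by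
  congr 1; rw [sub_eq_add_neg, ← neg_smul]; congr 2; ring

lemma Eex_inv {p : ℕ} (A : Matrix (Fin p) (Fin p) ℝ) (x t : ℝ) :
    Eex A x t * mexp ((2 * x) • A - (8 * t) • A ^ 3) = 1 ∧
     mexp ((2 * x) • A - (8 * t) • A ^ 3) * Eex A x t = 1 := by
  have : (2 * x) • A - (8 * t) • A ^ 3 = -(-((2 * x) • A) + (8 * t) • A ^ 3) := by abel
  rw [this]
  exact ⟨mexp_mul_neg _, mexp_neg_mul _⟩

lemma eT {p : ℕ} (A : Matrix (Fin p) (Fin p) ℝ) (x t : ℝ) :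
    mexp ((2 * x) • Aᵀ - (8 * t) • Aᵀ ^ 3) = (mexp ((2 * x) • A - (8 * t) • A ^ 3))ᵀ := by
  rw [← mexp_transpose]; simp [Matrix.transpose_pow]

noncomputable def Xm {p : ℕ} (A : Matrix (Fin p) (Fin p) ℝ) (B : Matrix (Fin p) (Fin 1) ℝ)
    (C : Matrix (Fin 1) (Fin p) ℝ) (x t : ℝ) : Matrix (Fin p) (Fin p) ℝ :=
  Eex A x t * Nmat A B * (Fmat A B C x t)⁻¹

noncomputable def al {p : ℕ} (A : Matrix (Fin p) (Fin p) ℝ) (B : Matrix (Fin p) (Fin 1) ℝ)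
    (C : Matrix (Fin 1) (Fin p) ℝ) (k : ℕ) (x t : ℝ) : ℝ :=
  (Bᵀ * (Fmat A B C x t)⁻¹ * (Aᵀ ^ k * Cᵀ)) 0 0

noncomputable def be {p : ℕ} (A : Matrix (Fin p) (Fin p) ℝ) (B : Matrix (Fin p) (Fin 1) ℝ)
    (C : Matrix (Fin 1) (Fin p) ℝ) (j k : ℕ) (x t : ℝ) : ℝ :=
  (C * A ^ j * Xm A B C x t * (Aᵀ ^ k * Cᵀ)) 0 0

lemma mul11 (M K : Matrix (Fin 1) (Fin 1) ℝ) : (M * K) 0 0 = M 0 0 * K 0 0 := by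
  simp [Matrix.mul_apply]

section pde
variable {p : ℕ} {A : Matrix (Fin p) (Fin p) ℝ} {B : Matrix (Fin p) (Fin 1) ℝ}
  {C : Matrix (Fin 1) (Fin p) ℝ}
  (hQ : Aᵀ * Qmat A C + Qmat A C * A = Cᵀ * C) (hN : A * Nmat A B + Nmat A B * Aᵀ = B * Bᵀ)
  (hQs : (Qmat A C)ᵀ = Qmat A C) (hNs : (Nmat A B)ᵀ = Nmat A B)
  (hU : ∀ x t, IsUnit (Fmat A B C x t))

lemma F_eq (x t : ℝ) : Fmat A B C x t = mexp ((2 * x) • Aᵀ - (8 * t) • Aᵀ ^ 3) +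
    Qmat A C * Eex A x t * Nmat A B := rfl

lemma E_comm (x t : ℝ) : A * Eex A x t = Eex A x t * A := by
  rw [Eex_eq]; exact mexp_comm _ _ (pow_comm' A _ _)

lemma e_comm (x t : ℝ) : A * mexp ((2 * x) • A - (8 * t) • A ^ 3)
    = mexp ((2 * x) • A - (8 * t) • A ^ 3) * A := by
  rw [eex_eq]; exact mexp_comm _ _ (pow_comm' A _ _)

include hU in
lemma FG (x t : ℝ) : Fmat A B C x t * (Fmat A B C x t)⁻¹ = 1 :=
  Matrix.mul_nonsing_inv _ ((Matrix.isUnit_iff_isUnit_det _).1 (hU x t))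
include hU in
lemma GF (x t : ℝ) : (Fmat A B C x t)⁻¹ * Fmat A B C x t = 1 :=
  Matrix.nonsing_inv_mul _ ((Matrix.isUnit_iff_isUnit_det _).1 (hU x t))

lemma E_dx (x t : ℝ) : HasDerivAt (fun x => Eex A x t) (-2 * (A * Eex A x t)) x := by
  simp only [Eex_eq]
  convert mexp_dx A (-2) (8 * t) x using 1
  rw [smul_mul_assoc, neg_smul, neg_mul, two_mul, two_smul]

lemma E_dt (x t : ℝ) : HasDerivAt (fun t => Eex A x t) (8 * (A ^ 3 * Eex A x t)) t := by
  simp only [Eex_eq]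
  convert mexp_dt A 8 (-2 * x) t using 1
  rw [smul_mul_assoc, ofNat_smul_eq_nsmul, nsmul_eq_mul]; norm_num

lemma e_dx (x t : ℝ) : HasDerivAt (fun x => mexp ((2 * x) • A - (8 * t) • A ^ 3))
    (2 * (A * mexp ((2 * x) • A - (8 * t) • A ^ 3))) x := by
  simp only [eex_eq]
  convert mexp_dx A (2) (-8 * t) x using 1
  rw [smul_mul_assoc, two_mul, two_smul]

lemma e_dt (x t : ℝ) : HasDerivAt (fun t => mexp ((2 * x) • A - (8 * t) • A ^ 3))
    (-8 * (A ^ 3 * mexp ((2 * x) • A - (8 * t) • A ^ 3))) t := by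
  simp only [eex_eq]
  convert mexp_dt A (-8) (2 * x) t using 1
  rw [smul_mul_assoc, neg_smul, ofNat_smul_eq_nsmul, nsmul_eq_mul]; norm_num

include hQ hU in
lemma G_dx (x t : ℝ) : HasDerivAt (fun x => (Fmat A B C x t)⁻¹)
    (-2 * ((Fmat A B C x t)⁻¹ * Aᵀ) + 2 * ((Fmat A B C x t)⁻¹ * (Cᵀ * C) * Xm A B C x t)) x := by
  have h := ((e_dx (A := Aᵀ) x t).add (((E_dx (A := A) x t).const_mul (Qmat A C)).mul_const (Nmat A B)))
  have h2 := inv_deriv (fun x => Fmat A B C x t) _ x h (hU x t)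
  convert h2 using 1
  unfold Xm
  rw [← alg_x (F_eq (A := A) (B := B) (C := C) x t) (FG hU x t) hQ]
  noncomm_ring

include hQ hU in
lemma G_dt (x t : ℝ) : HasDerivAt (fun t => (Fmat A B C x t)⁻¹)
    (8 * ((Fmat A B C x t)⁻¹ * Aᵀ ^ 3) - 8 * ((Fmat A B C x t)⁻¹ *
      ((Cᵀ * C) * A ^ 2 - Aᵀ * (Cᵀ * C) * A + Aᵀ ^ 2 * (Cᵀ * C)) * Xm A B C x t)) t := by
  have h := ((e_dt (A := Aᵀ) x t).add (((E_dt (A := A) x t).const_mul (Qmat A C)).mul_const (Nmat A B)))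
  have h2 := inv_deriv (fun t => Fmat A B C x t) _ t h (hU x t)
  convert h2 using 1
  unfold Xm
  rw [← alg_t (F_eq (A := A) (B := B) (C := C) x t) (FG hU x t) hQ]
  noncomm_ring

include hQs hNs in
lemma FT (x t : ℝ) : (Fmat A B C x t)ᵀ = mexp ((2 * x) • A - (8 * t) • A ^ 3) +
    Nmat A B * (Eex A x t)ᵀ * Qmat A C := by
  rw [F_eq, eT]
  simp [Matrix.transpose_mul, hQs, hNs, mul_assoc]

include hU hQs hNs in
lemma D_eq (x t : ℝ) : Eex A x t - Xm A B C x t * Qmat A C * Eex A x t = ((Fmat A B C x t)⁻¹)ᵀ := by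
  have h := alg_D (F_eq (A := A) (B := B) (C := C) x t) (GF hU x t) (Eex_inv A x t).1
    (Et := (Eex A x t)ᵀ) (by rw [eT, ← Matrix.transpose_mul, (Eex_inv A x t).1, Matrix.transpose_one])
  rw [← FT hQs hNs] at h
  have h3 : (Fmat A B C x t)ᵀ * ((Fmat A B C x t)⁻¹)ᵀ = 1 := by
    rw [← Matrix.transpose_mul, GF hU, Matrix.transpose_one]
  exact left_inv_eq_right_inv h h3

include hU hQs hNs in
lemma X_symm (x t : ℝ) : (Xm A B C x t)ᵀ = Xm A B C x t := by
  have h3 : ((Fmat A B C x t)⁻¹)ᵀ * (Fmat A B C x t)ᵀ = 1 := by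
    rw [← Matrix.transpose_mul, FG hU, Matrix.transpose_one]
  have h4 : (Fmat A B C x t)ᵀ * (Eex A x t * Nmat A B)
      = Nmat A B * (Eex A x t)ᵀ * Fmat A B C x t := by
    rw [FT hQs hNs, F_eq, eT]
    have e1 := (Eex_inv A x t).2
    have e2 : (Eex A x t)ᵀ * (mexp ((2 * x) • A - (8 * t) • A ^ 3))ᵀ = 1 := by
      rw [← Matrix.transpose_mul, e1, Matrix.transpose_one]
    rw [add_mul, mul_add, ← mul_assoc, e1, mul_assoc (Nmat A B) _ (mexp _)ᵀ, e2]
    noncomm_ring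
  have h5 : Xm A B C x t = ((Fmat A B C x t)⁻¹)ᵀ * ((Fmat A B C x t)ᵀ * (Eex A x t * Nmat A B))
      * (Fmat A B C x t)⁻¹ := by
    rw [← mul_assoc _ (Fmat A B C x t)ᵀ, h3, one_mul]; rfl
  rw [h4] at h5
  rw [mul_assoc, mul_assoc _ (Fmat A B C x t), FG hU, mul_one] at h5
  conv_rhs => rw [h5]
  simp [Xm, Matrix.transpose_mul, hNs]

include hQ hN hU hQs hNs in
lemma X_alg (x t : ℝ) : A * Xm A B C x t + Xm A B C x t * Aᵀ
    = ((Fmat A B C x t)⁻¹)ᵀ * (B * Bᵀ) * (Fmat A B C x t)⁻¹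
      + Xm A B C x t * (Cᵀ * C) * Xm A B C x t := by
  rw [← D_eq hQs hNs hU]
  exact alg_main (F_eq (A := A) (B := B) (C := C) x t) (FG hU x t) (GF hU x t) hQ hN
    (E_comm x t) (e_comm (A := Aᵀ) x t)

include hQ hN hU hQs hNs in
lemma X_dx (x t : ℝ) : HasDerivAt (fun x => Xm A B C x t)
    (-2 * (((Fmat A B C x t)⁻¹)ᵀ * (B * Bᵀ) * (Fmat A B C x t)⁻¹)) x := by
  have h := ((E_dx (A := A) x t).mul_const (Nmat A B)).mul (G_dx hQ hU x t)
  refine HasDerivAt.congr_deriv (f := fun x => Xm A B C x t) h ?_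
  symm
  rw [eq_sub_of_add_eq (X_alg hQ hN hQs hNs hU x t).symm]
  unfold Xm
  noncomm_ring

include hQ hU in
lemma al_dx (k : ℕ) (x t : ℝ) : HasDerivAt (fun x => al A B C k x t)
    (-2 * al A B C (k + 1) x t + 2 * (al A B C 0 x t * be A B C 0 k x t)) x := by
  refine HasDerivAt.congr_deriv (entry_deriv _ _ x (G_dx hQ hU x t) Bᵀ (Aᵀ ^ k * Cᵀ) 0 0) ?_
  have : Bᵀ * (-2 * ((Fmat A B C x t)⁻¹ * Aᵀ) +
      2 * ((Fmat A B C x t)⁻¹ * (Cᵀ * C) * Xm A B C x t)) * (Aᵀ ^ k * Cᵀ)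
    = (-2 : ℝ) • (Bᵀ * (Fmat A B C x t)⁻¹ * (Aᵀ ^ (k + 1) * Cᵀ))
      + (2 : ℝ) • ((Bᵀ * (Fmat A B C x t)⁻¹ * (Aᵀ ^ 0 * Cᵀ)) *
        (C * A ^ 0 * Xm A B C x t * (Aᵀ ^ k * Cᵀ))) := by
    have e1 : (2 : Matrix (Fin p) (Fin p) ℝ) = (2 : ℝ) • 1 := by
      rw [ofNat_smul_eq_nsmul]; simp
    rw [e1, pow_succ']
    simp only [Matrix.mul_add, Matrix.add_mul, Matrix.mul_assoc, neg_mul, smul_mul_assoc, one_mul,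
      Matrix.smul_mul, Matrix.mul_smul, pow_zero, Matrix.one_mul, Matrix.mul_neg, Matrix.neg_mul,
      neg_smul]
  rw [this, Matrix.add_apply, Matrix.smul_apply, Matrix.smul_apply, mul11]
  rfl

lemma al_T (j : ℕ) (x t : ℝ) : (C * A ^ j * ((Fmat A B C x t)⁻¹)ᵀ * B) 0 0 = al A B C j x t := by
  unfold al
  have : (C * A ^ j * ((Fmat A B C x t)⁻¹)ᵀ * B) = (Bᵀ * (Fmat A B C x t)⁻¹ * (Aᵀ ^ j * Cᵀ))ᵀ := by
    simp only [Matrix.transpose_mul, Matrix.transpose_transpose, Matrix.transpose_pow, Matrix.mul_assoc]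
  rw [this, Matrix.transpose_apply]

include hQ hN hU hQs hNs in
lemma be_dx (j k : ℕ) (x t : ℝ) : HasDerivAt (fun x => be A B C j k x t)
    (-2 * (al A B C j x t * al A B C k x t)) x := by
  refine HasDerivAt.congr_deriv (entry_deriv _ _ x (X_dx hQ hN hQs hNs hU x t) (C * A ^ j) (Aᵀ ^ k * Cᵀ) 0 0) ?_
  have : C * A ^ j * (-2 * (((Fmat A B C x t)⁻¹)ᵀ * (B * Bᵀ) * (Fmat A B C x t)⁻¹)) * (Aᵀ ^ k * Cᵀ)
    = (-2 : ℝ) • ((C * A ^ j * ((Fmat A B C x t)⁻¹)ᵀ * B) *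
        (Bᵀ * (Fmat A B C x t)⁻¹ * (Aᵀ ^ k * Cᵀ))) := by
    have e1 : (2 : Matrix (Fin p) (Fin p) ℝ) = (2 : ℝ) • 1 := by
      rw [ofNat_smul_eq_nsmul]; simp
    rw [e1]
    simp only [Matrix.mul_assoc, neg_mul, smul_mul_assoc, one_mul,
      Matrix.smul_mul, Matrix.mul_smul, Matrix.one_mul, Matrix.mul_neg, Matrix.neg_mul,
      neg_smul]
  rw [this, Matrix.smul_apply, mul11, al_T]
  rfl

include hQ hU in
lemma al_dt (x t : ℝ) : HasDerivAt (fun t => al A B C 0 x t)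
    (8 * al A B C 3 x t - 8 * (al A B C 0 x t * be A B C 2 0 x t
      - al A B C 1 x t * be A B C 1 0 x t + al A B C 2 x t * be A B C 0 0 x t)) t := by
  refine HasDerivAt.congr_deriv (entry_deriv _ _ t (G_dt hQ hU x t) Bᵀ (Aᵀ ^ 0 * Cᵀ) 0 0) ?_
  have : Bᵀ * (8 * ((Fmat A B C x t)⁻¹ * Aᵀ ^ 3) - 8 * ((Fmat A B C x t)⁻¹ *
      ((Cᵀ * C) * A ^ 2 - Aᵀ * (Cᵀ * C) * A + Aᵀ ^ 2 * (Cᵀ * C)) * Xm A B C x t)) * (Aᵀ ^ 0 * Cᵀ)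
    = (8 : ℝ) • (Bᵀ * (Fmat A B C x t)⁻¹ * (Aᵀ ^ 3 * Cᵀ))
      - (8 : ℝ) • (((Bᵀ * (Fmat A B C x t)⁻¹ * (Aᵀ ^ 0 * Cᵀ)) *
        (C * A ^ 2 * Xm A B C x t * (Aᵀ ^ 0 * Cᵀ)))
        - ((Bᵀ * (Fmat A B C x t)⁻¹ * (Aᵀ ^ 1 * Cᵀ)) *
        (C * A ^ 1 * Xm A B C x t * (Aᵀ ^ 0 * Cᵀ)))
        + ((Bᵀ * (Fmat A B C x t)⁻¹ * (Aᵀ ^ 2 * Cᵀ)) *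
        (C * A ^ 0 * Xm A B C x t * (Aᵀ ^ 0 * Cᵀ)))) := by
    have e1 : (8 : Matrix (Fin p) (Fin p) ℝ) = (8 : ℝ) • 1 := by
      rw [ofNat_smul_eq_nsmul]; simp
    rw [e1]
    simp only [Matrix.mul_add, Matrix.add_mul, Matrix.mul_sub, Matrix.sub_mul, Matrix.mul_assoc,
      smul_mul_assoc, one_mul, smul_add, smul_sub, pow_one,
      Matrix.smul_mul, Matrix.mul_smul, pow_zero, Matrix.one_mul]
  rw [this]
  simp only [Matrix.sub_apply, Matrix.add_apply, Matrix.smul_apply, mul11]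
  rfl

include hU hQs hNs in
lemma be_symm (j k : ℕ) (x t : ℝ) : be A B C j k x t = be A B C k j x t := by
  unfold be
  have : C * A ^ j * Xm A B C x t * (Aᵀ ^ k * Cᵀ) = (C * A ^ k * Xm A B C x t * (Aᵀ ^ j * Cᵀ))ᵀ := by
    simp only [Matrix.transpose_mul, Matrix.transpose_transpose, Matrix.transpose_pow,
      Matrix.mul_assoc, X_symm hQs hNs hU]
  rw [this, Matrix.transpose_apply]

include hQ hN hU hQs hNs in
lemma be_01 (x t : ℝ) : 2 * be A B C 0 1 x t = al A B C 0 x t ^ 2 + be A B C 0 0 x t ^ 2 := by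
  have h := congrArg (fun M : Matrix (Fin p) (Fin p) ℝ => (C * A ^ 0 * M * (Aᵀ ^ 0 * Cᵀ) : Matrix (Fin 1) (Fin 1) ℝ) 0 0) (X_alg hQ hN hQs hNs hU x t)
  have e1 : C * A ^ 0 * (A * Xm A B C x t + Xm A B C x t * Aᵀ) * (Aᵀ ^ 0 * Cᵀ)
     = C * A ^ 1 * Xm A B C x t * (Aᵀ ^ 0 * Cᵀ) + C * A ^ 0 * Xm A B C x t * (Aᵀ ^ 1 * Cᵀ) := by
    simp only [Matrix.mul_add, Matrix.add_mul, Matrix.mul_assoc, pow_zero, pow_one, Matrix.one_mul]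
  have e2 : C * A ^ 0 * (((Fmat A B C x t)⁻¹)ᵀ * (B * Bᵀ) * (Fmat A B C x t)⁻¹
      + Xm A B C x t * (Cᵀ * C) * Xm A B C x t) * (Aᵀ ^ 0 * Cᵀ)
     = (C * A ^ 0 * ((Fmat A B C x t)⁻¹)ᵀ * B) * (Bᵀ * (Fmat A B C x t)⁻¹ * (Aᵀ ^ 0 * Cᵀ))
      + (C * A ^ 0 * Xm A B C x t * (Aᵀ ^ 0 * Cᵀ)) * (C * A ^ 0 * Xm A B C x t * (Aᵀ ^ 0 * Cᵀ)) := by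
    simp only [Matrix.mul_add, Matrix.add_mul, Matrix.mul_assoc, pow_zero, Matrix.one_mul]
  simp only [e1, e2, Matrix.add_apply, mul11, al_T] at h
  have h' : be A B C 1 0 x t + be A B C 0 1 x t = al A B C 0 x t * al A B C 0 x t
    + be A B C 0 0 x t * be A B C 0 0 x t := h
  rw [be_symm hQs hNs hU 1 0] at h'
  linarith

include hQ hN hU hQs hNs in
lemma pde_main (x t : ℝ) : deriv (fun τ : ℝ => uFun A B C x τ) t
        + iteratedDeriv 3 (fun ξ : ℝ => uFun A B C ξ t) x
        + 6 * (uFun A B C x t) ^ 2 * deriv (fun ξ : ℝ => uFun A B C ξ t) x = 0 := by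
  have hu : ∀ x t, uFun A B C x t = -2 * al A B C 0 x t := fun x t => by
    simp [uFun, al]
  simp only [hu]
  rw [((al_dt hQ hU x t).const_mul (-2)).deriv]
  have ha := fun k x => al_dx (B := B) hQ hU k x t
  have hb := fun j k x => be_dx hQ hN hQs hNs hU j k x t
  have d1 : deriv (fun x => -2 * al A B C 0 x t) = fun x =>
    -2 * (-2 * al A B C 1 x t + 2 * (al A B C 0 x t * be A B C 0 0 x t)) :=
    funext fun x => ((ha 0 x).const_mul (-2)).deriv
  have h2 := fun x => (((ha 1 x).const_mul (-2)).add
    (((ha 0 x).mul (hb 0 0 x)).const_mul 2)).const_mul (-2)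
  have d2 := funext fun x => (h2 x).deriv
  have h3 := fun x => ((((ha 2 x).const_mul (-2)).add (((ha 0 x).mul (hb 0 1 x)).const_mul 2)).const_mul (-2)).add
    (((((((ha 1 x).const_mul (-2)).add
    (((ha 0 x).mul (hb 0 0 x)).const_mul 2))).mul (hb 0 0 x)).add
      ((ha 0 x).mul (((ha 0 x).mul (ha 0 x)).const_mul (-2)))).const_mul 2)
  have d3 := fun x => ((h3 x).const_mul (-2)).deriv
  rw [iteratedDeriv_succ, iteratedDeriv_succ, iteratedDeriv_one, d1]
  simp only [Pi.add_apply, Pi.mul_apply, Pi.add_def, Pi.mul_def, zero_add, Nat.reduceAdd] at d2 d3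
  rw [d2, d3]
  have s1 := be_01 hQ hN hQs hNs hU x t
  have s2 := be_symm (B := B) (C := C) hQs hNs hU 2 0 x t
  have s3 := be_symm (B := B) (C := C) hQs hNs hU 1 0 x t
  rw [s2, s3]
  linear_combination (-16) * (al A B C 1 x t - al A B C 0 x t * be A B C 0 0 x t) * s1
end pde


def Dec {K : Type*} [Norm K] (f : ℝ → K) : Prop :=
  ∃ b : ℝ, 0 < b ∧ f =O[atTop] fun s : ℝ => Real.exp (-b * s)

lemma exp_mono_O {b c : ℝ} (h : b ≤ c) :
    (fun s : ℝ => Real.exp (-c * s)) =O[atTop] fun s : ℝ => Real.exp (-b * s) := by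
  apply Asymptotics.IsBigO.of_bound 1
  filter_upwards [eventually_ge_atTop 0] with s hs
  rw [one_mul, Real.norm_of_nonneg (Real.exp_pos _).le, Real.norm_of_nonneg (Real.exp_pos _).le]
  apply Real.exp_le_exp.2
  nlinarith

lemma O_of_norm_eq {K K' : Type*} [NormedField K] [NormedField K'] {f : ℝ → K} {f' : ℝ → K'} {g : ℝ → ℝ}
    (h : f =O[atTop] g) (e : ∀ s, ‖f s‖ = ‖f' s‖) : f' =O[atTop] g :=
  (h.norm_left.congr_left e).of_norm_left

section
variable {K : Type*} [NormedField K] {f g : ℝ → K}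

lemma Dec.add (hf : Dec f) (hg : Dec g) : Dec (fun s => f s + g s) := by
  obtain ⟨b, hb, h1⟩ := hf
  obtain ⟨c, hc, h2⟩ := hg
  exact ⟨min b c, lt_min hb hc, (h1.trans (exp_mono_O (min_le_left _ _))).add
    (h2.trans (exp_mono_O (min_le_right _ _)))⟩

lemma Dec.zero : Dec (fun _ : ℝ => (0 : K)) :=
  ⟨1, one_pos, Asymptotics.isBigO_zero _ _⟩

lemma Dec.const_mul (c : K) (hf : Dec f) : Dec (fun s => c * f s) := by
  obtain ⟨b, hb, h1⟩ := hf
  exact ⟨b, hb, h1.const_mul_left c⟩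

lemma Dec.mul (hf : Dec f) (hg : Dec g) : Dec (fun s => f s * g s) := by
  obtain ⟨b, hb, h1⟩ := hf
  obtain ⟨c, hc, h2⟩ := hg
  refine ⟨b + c, add_pos hb hc, ?_⟩
  refine (h1.mul h2).congr_right fun s => ?_
  rw [← Real.exp_add]; congr 1; ring

lemma Dec.sum {ι : Type*} (s : Finset ι) (f : ι → ℝ → K) (h : ∀ i ∈ s, Dec (f i)) :
    Dec (fun x => ∑ i ∈ s, f i x) := by
  classical
  induction s using Finset.induction_on with
  | empty => simpa using Dec.zero
  | insert a s ha ih =>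
    simp only [Finset.sum_insert ha]
    exact (h a (Finset.mem_insert_self _ _)).add (ih fun i hi => h i (Finset.mem_insert_of_mem hi))
end

lemma Dec.tendsto {f : ℝ → ℝ} (hf : Dec f) : Tendsto f atTop (nhds 0) := by
  obtain ⟨b, hb, h1⟩ := hf
  refine h1.trans_tendsto ?_
  refine Real.tendsto_exp_atBot.comp ?_
  exact tendsto_id.const_mul_atTop_of_neg (by linarith)

lemma Dec.integrable {f : ℝ → ℝ} (hf : Dec f) (hc : Continuous f) : IntegrableOn f (Set.Ioi 0) := by
  obtain ⟨b, hb, h1⟩ := hf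
  exact integrable_of_isBigO_exp_neg hb hc.continuousOn h1

lemma dec_poly (μ : ℂ) (hμ : 0 < μ.re) (n : ℕ) :
    Dec (fun s : ℝ => Complex.exp (-(s : ℂ) * μ) * (-(s : ℂ)) ^ n) := by
  refine ⟨μ.re / 2, by linarith, ?_⟩
  have h := (isLittleO_pow_exp_pos_mul_atTop n (half_pos hμ)).isBigO
  have h2 := (Asymptotics.isBigO_refl (fun s : ℝ => Real.exp (-μ.re * s)) atTop).mul h
  have h3 : (fun s : ℝ => Real.exp (-μ.re * s) * Real.exp (μ.re / 2 * s))
     = fun s => Real.exp (-(μ.re / 2) * s) := by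
    funext s; rw [← Real.exp_add]; congr 1; ring
  rw [h3] at h2
  refine O_of_norm_eq h2 ?_
  intro s
  simp [Complex.norm_exp, mul_comm]

section
variable {p : ℕ}

lemma exp_mulVec_fin (K : Matrix (Fin p) (Fin p) ℂ) (v : Fin p → ℂ) (k : ℕ)
    (hk : (K ^ k) *ᵥ v = 0) (z : ℂ) (i : Fin p) :
    (NormedSpace.exp (z • K) *ᵥ v) i =
      ∑ n ∈ Finset.range k, z ^ n * ((n.factorial : ℂ)⁻¹ * ((K ^ n) *ᵥ v) i) := by
  have h := NormedSpace.exp_series_hasSum_exp' (𝕂 := ℂ) (z • K)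
  let f : Matrix (Fin p) (Fin p) ℂ →ₗ[ℂ] ℂ :=
    { toFun := fun M => (M *ᵥ v) i
      map_add' := fun M N => by simp [Matrix.add_mulVec]
      map_smul' := fun r M => by simp [Matrix.smul_mulVec] }
  have h2 := h.mapL (LinearMap.toContinuousLinearMap f)
  have h3 : ∀ n, (LinearMap.toContinuousLinearMap f) ((n.factorial : ℂ)⁻¹ • (z • K) ^ n)
      = z ^ n * ((n.factorial : ℂ)⁻¹ * ((K ^ n) *ᵥ v) i) := fun n => by
    change (((n.factorial : ℂ)⁻¹ • (z • K) ^ n) *ᵥ v) i = _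
    rw [smul_pow, smul_smul, Matrix.smul_mulVec, Pi.smul_apply, smul_eq_mul]
    ring
  simp only [h3] at h2
  refine h2.unique (hasSum_sum_of_ne_finset_zero fun n hn => ?_)
  have : k ≤ n := by simpa using hn
  have e : (K ^ n) *ᵥ v = 0 := by
    rw [← Nat.sub_add_cancel this, pow_add, ← Matrix.mulVec_mulVec, hk, Matrix.mulVec_zero]
  simp [e]

lemma exp_shift (M : Matrix (Fin p) (Fin p) ℂ) (μ z : ℂ) :
    NormedSpace.exp (z • M) = Complex.exp (z * μ) • NormedSpace.exp (z • (M - μ • 1)) := by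
  have e : z • M = algebraMap ℂ (Matrix (Fin p) (Fin p) ℂ) (z * μ) + z • (M - μ • 1) := by
    rw [Algebra.algebraMap_eq_smul_one, smul_sub, smul_smul]; abel
  have e2 : NormedSpace.exp (algebraMap ℂ (Matrix (Fin p) (Fin p) ℂ) (z * μ))
      = algebraMap ℂ (Matrix (Fin p) (Fin p) ℂ) (NormedSpace.exp (z * μ)) :=
    (NormedSpace.algebraMap_exp_comm (𝕂 := ℂ) (𝔸 := Matrix (Fin p) (Fin p) ℂ) (z * μ)).symm
  rw [e, Matrix.exp_add_of_commute _ _ (Algebra.commute_algebraMap_left _ _),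
    e2, Algebra.algebraMap_eq_smul_one, smul_mul_assoc,
    one_mul, Complex.exp_eq_exp_ℂ]

lemma cdecay (M : Matrix (Fin p) (Fin p) ℂ) (hM : ∀ μ ∈ spectrum ℂ M, 0 < μ.re)
    (v : Fin p → ℂ) (i : Fin p) :
    Dec (fun s : ℝ => (NormedSpace.exp ((-(s : ℂ)) • M) *ᵥ v) i) := by
  let W : Submodule ℂ (Fin p → ℂ) :=
    { carrier := {v | Dec (fun s : ℝ => (NormedSpace.exp ((-(s : ℂ)) • M) *ᵥ v) i)}
      add_mem' := fun {v w} hv hw => by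
        simp only [Set.mem_ofPred_eq, Matrix.mulVec_add, Pi.add_apply] at *
        exact hv.add hw
      zero_mem' := by
        simp only [Set.mem_ofPred_eq, Matrix.mulVec_zero, Pi.zero_apply]
        exact Dec.zero
      smul_mem' := fun c v hv => by
        simp only [Set.mem_ofPred_eq, Matrix.mulVec_smul, Pi.smul_apply, smul_eq_mul] at *
        exact hv.const_mul c }
  have hW : W = ⊤ := by
    rw [eq_top_iff, ← Module.End.iSup_maxGenEigenspace_eq_top (Matrix.toLin' M)]
    refine iSup_le fun μ => ?_
    intro w hw
    rw [Module.End.mem_maxGenEigenspace] at hw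
    obtain ⟨k, hk⟩ := hw
    by_cases hμ : μ ∈ spectrum ℂ M
    · have hk' : ((M - μ • 1) ^ k) *ᵥ w = 0 := by
        rw [← hk, ← Matrix.toLin'_apply, Matrix.toLin'_pow]
        simp [map_sub, Module.End.one_eq_id]
      change Dec _
      have e : ∀ s : ℝ, (NormedSpace.exp ((-(s : ℂ)) • M) *ᵥ w) i = ∑ n ∈ Finset.range k,
        ((n.factorial : ℂ)⁻¹ * (((M - μ • 1) ^ n) *ᵥ w) i) *
          (Complex.exp (-(s : ℂ) * μ) * (-(s : ℂ)) ^ n) := fun s => by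
        rw [exp_shift M μ, Matrix.smul_mulVec, Pi.smul_apply, exp_mulVec_fin _ _ k hk',
          Finset.smul_sum]
        refine Finset.sum_congr rfl fun n _ => ?_
        rw [smul_eq_mul]; ring
      simp only [e]
      exact Dec.sum _ _ fun n _ => (dec_poly μ (hM μ hμ) n).const_mul _
    · rw [← Matrix.spectrum_toLin', spectrum.notMem_iff] at hμ
      have h2 : IsUnit ((Matrix.toLin' M - μ • 1) ^ k) := by
        apply IsUnit.pow
        rw [Algebra.algebraMap_eq_smul_one] at hμ
        have h5 := IsUnit.neg hμ
        rwa [neg_sub] at h5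
      have : w = 0 := by
        obtain ⟨U, hU⟩ := h2
        rw [← hU] at hk
        have := congrArg (fun y => (↑U⁻¹ : Module.End ℂ (Fin p → ℂ)) y) hk
        simpa [← Module.End.mul_apply] using this
      rw [this]; exact W.zero_mem
  have : v ∈ W := by rw [hW]; trivial
  exact this

lemma rdecay (A : Matrix (Fin p) (Fin p) ℝ) (hA : EigPos A) (i j : Fin p) :
    Dec (fun s : ℝ => mexp (-(s • A)) i j) := by
  have h := cdecay (A.map Complex.ofReal) hA (Pi.single j 1) i
  obtain ⟨b, hb, h⟩ := h
  refine ⟨b, hb, O_of_norm_eq h (fun s => ?_)⟩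
  have e : NormedSpace.exp ((-(s : ℂ)) • A.map Complex.ofReal)
      = (mexp (-(s • A))).map Complex.ofReal := by
    rw [mexp_eq]
    have hc : Continuous (Complex.ofRealHom.mapMatrix : Matrix (Fin p) (Fin p) ℝ →+* _) := by
      change Continuous fun M : Matrix (Fin p) (Fin p) ℝ => M.map Complex.ofReal
      exact continuous_id.matrix_map Complex.continuous_ofReal
    have := NormedSpace.map_exp (Complex.ofRealHom.mapMatrix : Matrix (Fin p) (Fin p) ℝ →+* _) hc (-(s • A))
    refine Eq.trans ?_ this.symm
    congr 1
    ext i j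
    simp
  rw [e]
  simp

end

section gram
variable {p : ℕ}

noncomputable def Hm (M : Matrix (Fin p) (Fin p) ℝ) (L : Matrix (Fin p) (Fin 1) ℝ) (s : ℝ) :
    Matrix (Fin p) (Fin p) ℝ := mexp (-(s • M)) * (L * Lᵀ) * mexp (-(s • Mᵀ))

lemma mexpT (M : Matrix (Fin p) (Fin p) ℝ) (s : ℝ) : mexp (-(s • Mᵀ)) = (mexp (-(s • M)))ᵀ := by
  rw [← mexp_transpose]; simp

lemma mexp_ds (M : Matrix (Fin p) (Fin p) ℝ) (s : ℝ) :
    HasDerivAt (fun s : ℝ => mexp (-(s • M))) (-M * mexp (-(s • M))) s := by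
  have h := mexp_deriv 0 (-M) (Commute.zero_left _) s
  simpa only [zero_add, smul_neg] using h

lemma Hm_ds (M : Matrix (Fin p) (Fin p) ℝ) (L : Matrix (Fin p) (Fin 1) ℝ) (s : ℝ) :
    HasDerivAt (Hm M L) (-(M * Hm M L s + Hm M L s * Mᵀ)) s := by
  have h := ((mexp_ds M s).mul_const (L * Lᵀ)).mul (mexp_ds Mᵀ s)
  refine HasDerivAt.congr_deriv (f := Hm M L) h ?_
  have e : Mᵀ * mexp (-(s • Mᵀ)) = mexp (-(s • Mᵀ)) * Mᵀ :=
    mexp_comm _ _ ((Commute.refl Mᵀ).smul_right s).neg_right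
  rw [neg_mul, neg_mul Mᵀ, e]
  unfold Hm
  noncomm_ring

lemma Hm_cont (M : Matrix (Fin p) (Fin p) ℝ) (L : Matrix (Fin p) (Fin 1) ℝ) : Continuous (Hm M L) :=
  continuous_iff_continuousAt.2 fun s => (Hm_ds M L s).continuousAt

lemma Hm_cont' (M : Matrix (Fin p) (Fin p) ℝ) (L : Matrix (Fin p) (Fin 1) ℝ) (i j : Fin p) :
    Continuous (fun s => Hm M L s i j) := (Hm_cont M L).matrix_elem i j

lemma Hm_dec (M : Matrix (Fin p) (Fin p) ℝ) (L : Matrix (Fin p) (Fin 1) ℝ)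
    (h : ∀ i j, Dec (fun s : ℝ => mexp (-(s • M)) i j)) (i j : Fin p) :
    Dec (fun s => Hm M L s i j) := by
  simp only [Hm, mexpT, Matrix.mul_apply (M := _ * (L * Lᵀ)), Matrix.mul_apply (N := L * Lᵀ),
    Matrix.transpose_apply]
  refine Dec.sum _ _ fun k _ => Dec.mul (Dec.sum _ _ fun l _ => ?_) (h j k)
  simpa only [mul_comm] using (h i l).const_mul ((L * Lᵀ) l k)

lemma Hm_int (M : Matrix (Fin p) (Fin p) ℝ) (L : Matrix (Fin p) (Fin 1) ℝ)
    (h : ∀ i j, Dec (fun s : ℝ => mexp (-(s • M)) i j)) (i j : Fin p) :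
    IntegrableOn (fun s => Hm M L s i j) (Set.Ioi 0) := (Hm_dec M L h i j).integrable (Hm_cont' M L i j)

noncomputable def Gram (M : Matrix (Fin p) (Fin p) ℝ) (L : Matrix (Fin p) (Fin 1) ℝ) :
    Matrix (Fin p) (Fin p) ℝ := Matrix.of fun i j => ∫ s in Set.Ioi (0 : ℝ), Hm M L s i j

lemma Gram_symm (M : Matrix (Fin p) (Fin p) ℝ) (L : Matrix (Fin p) (Fin 1) ℝ) :
    (Gram M L)ᵀ = Gram M L := by
  have e : ∀ s, (Hm M L s)ᵀ = Hm M L s := fun s => by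
    simp [Hm, mexpT, Matrix.transpose_mul, Matrix.mul_assoc]
  ext i j
  simp only [Matrix.transpose_apply, Gram, Matrix.of_apply]
  congr 1; funext s
  rw [← Matrix.transpose_apply (Hm M L s), e]

lemma Gram_lyap (M : Matrix (Fin p) (Fin p) ℝ) (L : Matrix (Fin p) (Fin 1) ℝ)
    (h : ∀ i j, Dec (fun s : ℝ => mexp (-(s • M)) i j)) :
    M * Gram M L + Gram M L * Mᵀ = L * Lᵀ := by
  have hi := Hm_int M L h
  ext i j
  have e : ∀ s, (-(M * Hm M L s + Hm M L s * Mᵀ)) i j =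
      -((∑ k, M i k * Hm M L s k j) + ∑ k, Hm M L s i k * M j k) := fun s => by
    simp [Matrix.mul_apply]
  have d : ∀ s ∈ Set.Ici (0 : ℝ), HasDerivAt (fun s => Hm M L s i j)
      (-((∑ k, M i k * Hm M L s k j) + ∑ k, Hm M L s i k * M j k)) s := fun s _ => by
    rw [← e]
    simpa using entry_deriv _ _ s (Hm_ds M L s) 1 1 i j
  have i1 : IntegrableOn (fun s => ∑ k, M i k * Hm M L s k j) (Set.Ioi 0) :=
    integrable_finsetSum _ fun k _ => (hi k j).const_mul _
  have i2 : IntegrableOn (fun s => ∑ k, Hm M L s i k * M j k) (Set.Ioi 0) :=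
    integrable_finsetSum _ fun k _ => (hi i k).mul_const _
  have f := integral_Ioi_of_hasDerivAt_of_tendsto' d (i1.add i2).neg (Hm_dec M L h i j).tendsto
  rw [integral_neg, integral_add i1 i2, integral_finsetSum _ (fun k _ => (hi k j).const_mul _),
    integral_finsetSum _ (fun k _ => (hi i k).mul_const _)] at f
  simp only [integral_const_mul, integral_mul_const] at f
  have h0 : Hm M L 0 = L * Lᵀ := by
    simp [Hm, mexp_eq, NormedSpace.exp_zero]
  rw [h0] at f
  rw [Matrix.add_apply, Matrix.mul_apply, Matrix.mul_apply]
  simp only [Gram, Matrix.of_apply, Matrix.transpose_apply]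
  linarith

lemma Gram_nonneg (M : Matrix (Fin p) (Fin p) ℝ) (L : Matrix (Fin p) (Fin 1) ℝ)
    (h : ∀ i j, Dec (fun s : ℝ => mexp (-(s • M)) i j)) (v : Fin p → ℝ) :
    0 ≤ v ⬝ᵥ (Gram M L *ᵥ v) := by
  have hi := Hm_int M L h
  have e : v ⬝ᵥ (Gram M L *ᵥ v) = ∫ s in Set.Ioi (0 : ℝ), v ⬝ᵥ (Hm M L s *ᵥ v) := by
    simp only [dotProduct, Matrix.mulVec, Gram, Matrix.of_apply]
    rw [integral_finsetSum _ (fun i _ => ((integrable_finsetSum _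
      fun k _ => (hi i k).mul_const _).const_mul _))]
    refine Finset.sum_congr rfl fun i _ => ?_
    rw [integral_const_mul, integral_finsetSum _ (fun k _ => (hi i k).mul_const _)]
    simp only [integral_mul_const]
  rw [e]
  refine integral_nonneg fun s => ?_
  have e2 : v ⬝ᵥ (Hm M L s *ᵥ v) = (Lᵀ *ᵥ (mexp (-(s • Mᵀ)) *ᵥ v)) ⬝ᵥ (Lᵀ *ᵥ (mexp (-(s • Mᵀ)) *ᵥ v)) := by
    have : Hm M L s = (Lᵀ * mexp (-(s • Mᵀ)))ᵀ * (Lᵀ * mexp (-(s • Mᵀ))) := by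
      simp [Hm, mexpT, Matrix.transpose_mul, Matrix.mul_assoc]
    rw [this, ← Matrix.mulVec_mulVec, Matrix.dotProduct_mulVec, Matrix.vecMul_transpose,
      Matrix.mulVec_mulVec]
  rw [e2]
  exact Finset.sum_nonneg fun i _ => mul_self_nonneg _

lemma Gram_psd (M : Matrix (Fin p) (Fin p) ℝ) (L : Matrix (Fin p) (Fin 1) ℝ)
    (h : ∀ i j, Dec (fun s : ℝ => mexp (-(s • M)) i j)) : (Gram M L).PosSemidef :=
  Matrix.PosSemidef.of_dotProduct_mulVec_nonneg
    (by rw [Matrix.IsHermitian, Matrix.conjTranspose_eq_transpose_of_trivial, Gram_symm])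
    (fun v => by simpa using Gram_nonneg M L h v)

lemma F_unit (A : Matrix (Fin p) (Fin p) ℝ) (B : Matrix (Fin p) (Fin 1) ℝ)
    (C : Matrix (Fin 1) (Fin p) ℝ) (hQ : (Qmat A C).PosSemidef) (hN : (Nmat A B).PosSemidef)
    (x t : ℝ) : IsUnit (Fmat A B C x t) := by
  rw [← Matrix.mulVec_injective_iff_isUnit]
  rw [← Matrix.coe_mulVecLin, injective_iff_map_eq_zero]
  intro v hv
  rw [Matrix.mulVecLin_apply] at hv
  have h2 : (Eex A x t)ᵀ * (mexp ((2 * x) • A - (8 * t) • A ^ 3))ᵀ = 1 := by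
    rw [← Matrix.transpose_mul, (Eex_inv A x t).2, Matrix.transpose_one]
  have h1 : (Eex A x t)ᵀ * Fmat A B C x t
      = 1 + (Eex A x t)ᵀ * Qmat A C * Eex A x t * Nmat A B := by
    rw [F_eq, eT, mul_add, h2]; noncomm_ring
  have h3 := congrArg (fun w => (Eex A x t)ᵀ *ᵥ w) hv
  simp only [Matrix.mulVec_mulVec, h1, Matrix.mulVec_zero, Matrix.add_mulVec, Matrix.one_mulVec] at h3
  have h4 := congrArg (fun w => (Nmat A B *ᵥ v) ⬝ᵥ w) h3
  simp only [dotProduct_add, dotProduct_zero] at h4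
  have h5 : (Nmat A B *ᵥ v) ⬝ᵥ (((Eex A x t)ᵀ * Qmat A C * Eex A x t * Nmat A B) *ᵥ v)
     = (Eex A x t *ᵥ (Nmat A B *ᵥ v)) ⬝ᵥ (Qmat A C *ᵥ (Eex A x t *ᵥ (Nmat A B *ᵥ v))) := by
    simp only [Matrix.mul_assoc]
    rw [← Matrix.mulVec_mulVec, Matrix.dotProduct_mulVec, Matrix.vecMul_transpose]
    simp only [Matrix.mulVec_mulVec]
  have h6 := hQ.dotProduct_mulVec_nonneg (Eex A x t *ᵥ (Nmat A B *ᵥ v))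
  have h7 := hN.dotProduct_mulVec_nonneg v
  rw [star_trivial] at h6 h7
  rw [h5, dotProduct_comm] at h4
  have h8 : v ⬝ᵥ (Nmat A B *ᵥ v) = 0 := by linarith
  have h9 := (hN.dotProduct_mulVec_zero_iff v).1 (by rw [star_trivial]; exact h8)
  rw [← Matrix.mulVec_mulVec, h9, Matrix.mulVec_zero, add_zero] at h3
  exact h3

end gram

end helpers

theorem statement4 {p : ℕ} (hp : 0 < p) (A : Matrix (Fin p) (Fin p) ℝ)
    (B : Matrix (Fin p) (Fin 1) ℝ) (C : Matrix (Fin 1) (Fin p) ℝ)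
    (hA : EigPos A) (hobs : Observable A C) (hctrl : Controllable A B) :
    ∀ x t : ℝ,
      deriv (fun τ : ℝ => uFun A B C x τ) t
        + iteratedDeriv 3 (fun ξ : ℝ => uFun A B C ξ t) x
        + 6 * (uFun A B C x t) ^ 2 * deriv (fun ξ : ℝ => uFun A B C ξ t) x = 0 := by
  have hd := rdecay A hA
  have hdT : ∀ i j, Dec (fun s : ℝ => mexp (-(s • Aᵀ)) i j) := fun i j => by
    simp only [mexpT, Matrix.transpose_apply]
    exact hd j i
  have eQ : Qmat A C = Gram Aᵀ Cᵀ := rfl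
  have eN : Nmat A B = Gram A B := rfl
  intro x t
  refine pde_main ?_ ?_ ?_ ?_ (F_unit A B C ?_ ?_) x t
  · rw [eQ]; exact Gram_lyap Aᵀ Cᵀ hdT
  · rw [eN]; exact Gram_lyap A B hd
  · rw [eQ]; exact Gram_symm _ _
  · rw [eN]; exact Gram_symm _ _
  · rw [eQ]; exact Gram_psd _ _ hdT
  · rw [eN]; exact Gram_psd _ _ hd
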